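/- Let G be a graph with two edge-disjoint loopless factors M and M0 satisfying Δ(M) ≤ m and |E(M0)| ≤ m. If G is 2m-edge-connected, then G has an m-tree-connected factor H including M and excluding M0 such that G∖E(H∪M0) is (0,l)-partition-connected, where l(v) = ⌊d_G(v)/2⌋ − m for each vertex v. Furthermore, for an arbitrary given vertex z, one can instead take l(z) = ⌈d_G(z)/2⌉ − m. -/

import Mathlib

open Finset

variable {V E : Type*}

/-- Degree of vertex `v` in the multigraph whose edge set is `S`
(the ambient multigraph is given by the endpoint map `ends`); a loop counts twice. -/
def mdeg [DecidableEq V] (ends : E → V × V) (S : Finset E) (v : V) : ℕ :=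
  ∑ e ∈ S, ((if (ends e).1 = v then 1 else 0) + (if (ends e).2 = v then 1 else 0))

/-- The multigraph with edge set `S` is connected: all vertices are mutually reachable. -/
def MConnected (ends : E → V × V) (S : Finset E) : Prop :=
  ∀ u v : V, Relation.ReflTransGen
    (fun a b => ∃ e ∈ S, ends e = (a, b) ∨ ends e = (b, a)) u v

/-- `T` is (the edge set of) a spanning tree: connected and with `|V| - 1` edges. -/
def IsSpanningTree [Fintype V] (ends : E → V × V) (T : Finset E) : Prop :=
  MConnected ends T ∧ T.card + 1 = Fintype.card V

/-- `S` is `m`-tree-connected: it contains `m` pairwise edge-disjoint spanning trees. -/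
def TreeConnected [Fintype V] (ends : E → V × V) (m : ℕ) (S : Finset E) : Prop :=
  ∃ T : Fin m → Finset E, (∀ i, T i ⊆ S ∧ IsSpanningTree ends (T i)) ∧
    ∀ i j, i ≠ j → Disjoint (T i) (T j)

/-- The edges of `S` crossing the cut `(A, Aᶜ)`. -/
def cutEdges [DecidableEq V] (ends : E → V × V) (S : Finset E) (A : Finset V) : Finset E :=
  S.filter fun e => ¬(((ends e).1 ∈ A) ↔ ((ends e).2 ∈ A))

/-- `S` is `m`-edge-connected: every edge cut has at least `m` edges. -/
def EdgeConnected [Fintype V] [DecidableEq V] (ends : E → V × V) (m : ℕ) (S : Finset E) : Prop :=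
  ∀ A : Finset V, A.Nonempty → A ≠ Finset.univ → m ≤ (cutEdges ends S A).card

/-- Tail of the edge `e` under the orientation `σ`. -/
def otail (ends : E → V × V) (σ : E → Bool) (e : E) : V :=
  if σ e then (ends e).1 else (ends e).2

/-- Head of the edge `e` under the orientation `σ`. -/
def ohead (ends : E → V × V) (σ : E → Bool) (e : E) : V :=
  if σ e then (ends e).2 else (ends e).1

/-- Out-degree of `v` in the edge set `S` under the orientation `σ`. -/
def outDeg [DecidableEq V] (ends : E → V × V) (σ : E → Bool) (S : Finset E) (v : V) : ℕ :=
  (S.filter fun e => otail ends σ e = v).card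

/-- In-degree of `v` in the edge set `S` under the orientation `σ`. -/
def inDeg [DecidableEq V] (ends : E → V × V) (σ : E → Bool) (S : Finset E) (v : V) : ℕ :=
  (S.filter fun e => ohead ends σ e = v).card

/-- Out-degree in a directed graph, where `ends` itself records the orientation
(first component = tail, second component = head). -/
def outDegD [DecidableEq V] (ends : E → V × V) (S : Finset E) (v : V) : ℕ :=
  (S.filter fun e => (ends e).1 = v).card

/-- In-degree in a directed graph. -/
def inDegD [DecidableEq V] (ends : E → V × V) (S : Finset E) (v : V) : ℕ :=
  (S.filter fun e => (ends e).2 = v).card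

/-- `S` is `(m, l)`-partition-connected: it decomposes into an `m`-tree-connected factor
and a factor admitting an orientation in which every vertex `v` has out-degree at least `l v`. -/
def PartitionConnected [Fintype V] [DecidableEq V] [DecidableEq E]
    (ends : E → V × V) (m : ℕ) (l : V → ℤ) (S : Finset E) : Prop :=
  ∃ S₁ ⊆ S, TreeConnected ends m S₁ ∧
    ∃ σ : E → Bool, ∀ v, l v ≤ (outDeg ends σ (S \ S₁) v : ℤ)

/-- Number of edges of `S` with both ends in `A`. -/
def eIn [DecidableEq V] (ends : E → V × V) (S : Finset E) (A : Finset V) : ℕ :=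
  (S.filter fun e => (ends e).1 ∈ A ∧ (ends e).2 ∈ A).card

/-- Number of edges of `S` with one end in `A` and the other end in `B`. -/
def eBetween [DecidableEq V] (ends : E → V × V) (S : Finset E) (A B : Finset V) : ℕ :=
  (S.filter fun e =>
    ((ends e).1 ∈ A ∧ (ends e).2 ∈ B) ∨ ((ends e).1 ∈ B ∧ (ends e).2 ∈ A)).card

/-- Every edge of `S` crosses the bipartition `(X, Xᶜ)`. -/
def BipartiteWrt [DecidableEq V] (ends : E → V × V) (S : Finset E) (X : Finset V) : Prop :=
  ∀ e ∈ S, ¬(((ends e).1 ∈ X) ↔ ((ends e).2 ∈ X))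

/-- The multigraph with edge set `S` is bipartite. -/
def IsBipartiteG [DecidableEq V] (ends : E → V × V) (S : Finset E) : Prop :=
  ∃ X : Finset V, BipartiteWrt ends S X

/-- Bipartite index: the smallest number of edges whose deletion from `S`
leaves a bipartite factor. -/
noncomputable def biIndex [DecidableEq V] [DecidableEq E]
    (ends : E → V × V) (S : Finset E) : ℕ :=
  sInf {n | ∃ H ⊆ S, IsBipartiteG ends H ∧ n = (S \ H).card}

/-- `f : V → ZMod k` is compatible with the multigraph `S` with respect to the
bipartition `(X, Xᶜ)`. -/
def CompatibleWrt [Fintype V] [DecidableEq V] (ends : E → V × V) (S : Finset E)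
    {k : ℕ} (f : V → ZMod k) (X : Finset V) : Prop :=
  (∃ x : ℕ, x ≤ eIn ends S X ∧
    (∑ v ∈ X, f v) - 2 * (x : ZMod k) = ∑ v ∈ Xᶜ, f v) ∨
  (∃ y : ℕ, y ≤ eIn ends S Xᶜ ∧
    (∑ v ∈ X, f v) = (∑ v ∈ Xᶜ, f v) - 2 * (y : ZMod k))

/-- `f : V → ZMod k` is compatible with `S`: compatible with respect to every bipartition. -/
def Compatible [Fintype V] [DecidableEq V] (ends : E → V × V) (S : Finset E)
    {k : ℕ} (f : V → ZMod k) : Prop :=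
  ∀ X : Finset V, CompatibleWrt ends S f X

/-- A Rado-type theorem for integer monotone submodular functions. -/
theorem rado_submod {ι E : Type*} [Fintype ι] [DecidableEq ι] [Fintype E] [DecidableEq E]
    (f : ι → Finset E → ℤ) (h0 : ∀ i, f i ∅ = 0)
    (hmono : ∀ i A B, A ⊆ B → f i A ≤ f i B)
    (hsub : ∀ i A B, f i (A ∪ B) + f i (A ∩ B) ≤ f i A + f i B)
    (h : ∀ X : Finset E, (X.card : ℤ) ≤ ∑ i, f i X) :
    ∃ c : E → ι, (Fintype.card E : ℤ) ≤ ∑ i, f i (univ.filter fun e => c e = i) := by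
  classical
  let P : (E → Finset ι) → Prop := fun A =>
    ∀ X : Finset E, (X.card : ℤ) ≤ ∑ i, f i (X.filter fun e => i ∈ A e)
  have hex : ∃ n, ∃ A, P A ∧ ∑ e, (A e).card = n :=
    ⟨_, fun _ => univ, by intro X; simpa using h X, rfl⟩
  obtain ⟨A, hA, hAn⟩ := Nat.find_spec hex
  have hmin : ∀ A', P A' → ∑ e, (A e).card ≤ ∑ e, (A' e).card := by
    intro A' hA'
    rw [hAn]
    exact Nat.find_min' hex ⟨A', hA', rfl⟩
  have hne : ∀ e, (A e).Nonempty := by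
    intro e
    by_contra hcon
    rw [Finset.not_nonempty_iff_eq_empty] at hcon
    have := hA {e}
    simp [Finset.filter_singleton, hcon, h0] at this
  -- removing an element destroys the condition
  have hrem : ∀ e i, i ∈ A e → ∃ X : Finset E, e ∈ X ∧
      ∑ j, f j (X.filter fun x => j ∈ A x ∧ ¬ (x = e ∧ j = i)) + 1 ≤ (X.card : ℤ) := by
    intro e i hi
    by_contra hcon
    have hcon' : ∀ X : Finset E, e ∈ X → (X.card : ℤ) ≤
        ∑ j, f j (X.filter fun x => j ∈ A x ∧ ¬ (x = e ∧ j = i)) := by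
      intro X hX
      by_contra hlt
      exact hcon ⟨X, hX, by omega⟩
    have hP : P (fun x => (A x).filter fun j => ¬ (x = e ∧ j = i)) := by
      intro X
      by_cases heX : e ∈ X
      · have := hcon' X heX
        simpa only [Finset.mem_filter] using this
      · refine (hA X).trans (le_of_eq ?_)
        refine Finset.sum_congr rfl fun j _ => ?_
        congr 1
        refine Finset.filter_congr fun x hx => ?_
        have : x ≠ e := fun hh => heX (hh ▸ hx)
        simp [this]
    have h1 := hmin _ hP
    have h2 : ∑ x, ((A x).filter fun j => ¬ (x = e ∧ j = i)).card < ∑ x, (A x).card := by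
      refine Finset.sum_lt_sum (fun x _ => Finset.card_le_card (Finset.filter_subset _ _))
        ⟨e, mem_univ _, Finset.card_lt_card ?_⟩
      rw [Finset.filter_ssubset]
      exact ⟨i, hi, by simp⟩
    omega
  have huniq : ∀ e i j, i ∈ A e → j ∈ A e → i = j := by
    intro e i j hi hj
    by_contra hij
    obtain ⟨X, heX, hX⟩ := hrem e i hi
    obtain ⟨Y, heY, hY⟩ := hrem e j hj
    have hU := hA (X ∪ Y)
    have hI := hA ((X ∩ Y).erase e)
    have key : ∑ k, f k ((X ∪ Y).filter fun x => k ∈ A x)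
        + ∑ k, f k (((X ∩ Y).erase e).filter fun x => k ∈ A x)
        ≤ ∑ k, f k (X.filter fun x => k ∈ A x ∧ ¬ (x = e ∧ k = i))
        + ∑ k, f k (Y.filter fun x => k ∈ A x ∧ ¬ (x = e ∧ k = j)) := by
      rw [← Finset.sum_add_distrib, ← Finset.sum_add_distrib]
      refine Finset.sum_le_sum fun k _ => ?_
      refine le_trans (add_le_add (hmono k _ _ ?_) (hmono k _ _ ?_)) (hsub k _ _)
      · intro x hx
        simp only [Finset.mem_filter, Finset.mem_union] at hx ⊢
        by_cases hxe : x = e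
        · subst hxe
          by_cases hki : k = i
          · subst hki
            right; exact ⟨heY, hx.2, fun hh => hij hh.2⟩
          · left; exact ⟨heX, hx.2, fun hh => hki hh.2⟩
        · tauto
      · intro x hx
        simp only [Finset.mem_filter, Finset.mem_inter, Finset.mem_erase] at hx ⊢
        tauto
    have hc1 : (X ∪ Y).card + (X ∩ Y).card = X.card + Y.card := Finset.card_union_add_card_inter X Y
    have hc2 : ((X ∩ Y).erase e).card + 1 = (X ∩ Y).card :=
      Finset.card_erase_add_one (Finset.mem_inter.2 ⟨heX, heY⟩)
    omega
  choose c hc using hne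
  refine ⟨c, ?_⟩
  have := hA univ
  refine this.trans (le_of_eq ?_)
  refine Finset.sum_congr rfl fun i _ => ?_
  congr 1
  refine Finset.filter_congr fun x _ => ⟨fun hi => huniq x _ _ (hc x) hi, fun hi => hi ▸ hc x⟩

/-- Functions on the vertices that are constant along all edges of `X`. -/
def potSpace (ends : E → V × V) (X : Finset E) : Submodule ℚ (V → ℚ) where
  carrier := {f | ∀ e ∈ X, f (ends e).1 = f (ends e).2}
  add_mem' := by
    intro f g hf hg e he
    simp [hf e he, hg e he]
  zero_mem' := by intro e _; rfl
  smul_mem' := by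
    intro a f hf e he
    simp [hf e he]

theorem mem_potSpace (ends : E → V × V) (X : Finset E) (f : V → ℚ) :
    f ∈ potSpace ends X ↔ ∀ e ∈ X, f (ends e).1 = f (ends e).2 := Iff.rfl

theorem potSpace_anti (ends : E → V × V) {X Y : Finset E} (h : X ⊆ Y) :
    potSpace ends Y ≤ potSpace ends X := fun _ hf e he => hf e (h he)

/-- The number of components of the graph with edge set `X`, as a dimension. -/
noncomputable def compNum (ends : E → V × V) (X : Finset E) : ℕ :=
  Module.finrank ℚ (potSpace ends X)

theorem compNum_anti [Fintype V] (ends : E → V × V) {X Y : Finset E} (h : X ⊆ Y) :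
    compNum ends Y ≤ compNum ends X := Submodule.finrank_mono (potSpace_anti ends h)

theorem compNum_empty [Fintype V] (ends : E → V × V) : compNum ends ∅ = Fintype.card V := by
  have : potSpace ends ∅ = ⊤ := by
    ext f; simp [mem_potSpace]
  rw [compNum, this, finrank_top, Module.finrank_fintype_fun_eq_card]

theorem compNum_super [Fintype V] [DecidableEq E] (ends : E → V × V) (X Y : Finset E) :
    compNum ends X + compNum ends Y ≤ compNum ends (X ∪ Y) + compNum ends (X ∩ Y) := by
  have h1 : potSpace ends (X ∪ Y) = potSpace ends X ⊓ potSpace ends Y := by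
    ext f
    simp only [mem_potSpace, Submodule.mem_inf, Finset.mem_union]
    constructor
    · intro h; exact ⟨fun e he => h e (Or.inl he), fun e he => h e (Or.inr he)⟩
    · rintro ⟨h, h'⟩ e (he | he)
      exacts [h e he, h' e he]
  have h2 : potSpace ends X ⊔ potSpace ends Y ≤ potSpace ends (X ∩ Y) :=
    sup_le (potSpace_anti ends Finset.inter_subset_left)
      (potSpace_anti ends Finset.inter_subset_right)
  have h3 := Submodule.finrank_sup_add_finrank_inf_eq (potSpace ends X) (potSpace ends Y)
  have h4 := Submodule.finrank_mono h2
  unfold compNum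
  rw [h1]
  omega

/-- Equivalence relation generated by the edges of `X`. -/
def compSetoid (ends : E → V × V) (X : Finset E) : Setoid V :=
  Relation.EqvGen.setoid (fun a b => ∃ e ∈ X, ends e = (a, b))

theorem potSpace_const (ends : E → V × V) (X : Finset E) (f : V → ℚ) (hf : f ∈ potSpace ends X)
    {a b : V} (h : Relation.EqvGen (fun a b => ∃ e ∈ X, ends e = (a, b)) a b) : f a = f b := by
  induction h with
  | rel a b h =>
    obtain ⟨e, he, hab⟩ := h
    have := hf e he
    rwa [hab] at this
  | refl => rfl
  | symm _ _ _ ih => exact ih.symm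
  | trans _ _ _ _ _ ih1 ih2 => exact ih1.trans ih2

theorem compNum_eq_card [Fintype V] (ends : E → V × V) (X : Finset E)
    [Fintype (Quotient (compSetoid ends X))] :
    compNum ends X = Fintype.card (Quotient (compSetoid ends X)) := by
  let L : (Quotient (compSetoid ends X) → ℚ) →ₗ[ℚ] (V → ℚ) :=
    LinearMap.funLeft ℚ ℚ (Quotient.mk (compSetoid ends X))
  have hinj : Function.Injective L :=
    LinearMap.funLeft_injective_of_surjective ℚ ℚ _ Quotient.mk_surjective
  have hrange : LinearMap.range L = potSpace ends X := by
    ext f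
    constructor
    · rintro ⟨g, rfl⟩ e he
      show g _ = g _
      congr 1
      exact Quotient.sound (Relation.EqvGen.rel _ _ ⟨e, he, rfl⟩)
    · intro hf
      refine ⟨Quotient.lift f fun a b hab => potSpace_const ends X f hf hab, ?_⟩
      ext v; rfl
  rw [compNum, ← hrange, LinearMap.finrank_range_of_inj hinj, Module.finrank_fintype_fun_eq_card]

theorem connected_of_compNum [Fintype V] (ends : E → V × V) (X : Finset E)
    (h : compNum ends X ≤ 1) : MConnected ends X := by
  classical
  rw [compNum_eq_card, Fintype.card_le_one_iff_subsingleton] at h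
  intro u v
  have huv : Relation.EqvGen (fun a b => ∃ e ∈ X, ends e = (a, b)) u v :=
    Quotient.exact (Subsingleton.elim (Quotient.mk (compSetoid ends X) u) (Quotient.mk _ v))
  have hS : Std.Symm (fun a b => ∃ e ∈ X, ends e = (a, b) ∨ ends e = (b, a)) := by
    constructor
    rintro a b ⟨e, he, h⟩
    exact ⟨e, he, h.symm⟩
  induction huv with
  | rel a b h =>
    obtain ⟨e, he, hab⟩ := h
    exact Relation.ReflTransGen.single ⟨e, he, Or.inl hab⟩
  | refl => exact Relation.ReflTransGen.refl
  | symm _ _ _ ih => exact (Relation.ReflTransGen.stdSymm).symm _ _ ih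
  | trans _ _ _ _ _ ih1 ih2 => exact ih1.trans ih2

theorem exists_forest [Fintype V] [DecidableEq E] (ends : E → V × V) (X : Finset E) :
    ∃ B ⊆ X, potSpace ends B = potSpace ends X ∧ B.card + compNum ends B = Fintype.card V := by
  induction X using Finset.induction_on with
  | empty => exact ⟨∅, subset_rfl, rfl, by simp [compNum_empty]⟩
  | insert e X heX ih =>
    obtain ⟨B, hBX, hK, hc⟩ := ih
    let φ : (V → ℚ) →ₗ[ℚ] ℚ := 
      LinearMap.proj (R := ℚ) (φ := fun _ : V => ℚ) (ends e).1 -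
        LinearMap.proj (R := ℚ) (φ := fun _ : V => ℚ) (ends e).2
    have hins : ∀ Y : Finset E, potSpace ends (insert e Y) = potSpace ends Y ⊓ LinearMap.ker φ := by
      intro Y
      ext f
      simp only [mem_potSpace, Submodule.mem_inf, LinearMap.mem_ker, Finset.mem_insert,
        forall_eq_or_imp, φ, LinearMap.sub_apply, LinearMap.proj_apply, sub_eq_zero]
      tauto
    by_cases hle : potSpace ends B ≤ LinearMap.ker φ
    · refine ⟨B, hBX.trans (Finset.subset_insert _ _), ?_, hc⟩
      rw [hins, ← hK, inf_eq_left.2 hle]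
    · refine ⟨insert e B, Finset.insert_subset_insert _ hBX, by rw [hins, hins, hK], ?_⟩
      rw [Finset.card_insert_of_notMem (fun h => heX (hBX h))]
      have hfr : compNum ends (insert e B) + 1 = compNum ends B := by
        let ψ : potSpace ends B →ₗ[ℚ] ℚ := φ.domRestrict (potSpace ends B)
        have h1 := LinearMap.finrank_range_add_finrank_ker ψ
        have hker : (LinearMap.ker ψ).map (potSpace ends B).subtype
            = potSpace ends (insert e B) := by
          rw [hins]
          ext f
          simp [ψ, LinearMap.mem_ker, and_comm]
        have h2 : Module.finrank ℚ (LinearMap.ker ψ) = compNum ends (insert e B) := by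
          rw [compNum, ← hker]
          exact (Submodule.finrank_map_subtype_eq _ _).symm
        have h3 : LinearMap.range ψ = ⊤ := by
          apply LinearMap.range_eq_top.2
          apply LinearMap.surjective
          intro h0
          apply hle
          intro f hf
          exact congrArg (fun g => g ⟨f, hf⟩) h0
        rw [h3, finrank_top, Module.finrank_self, h2] at h1
        unfold compNum at *
        omega
      omega

theorem exists_spanningTree [Fintype V] [DecidableEq E] [Nonempty V] (ends : E → V × V)
    (X : Finset E) (h : compNum ends X ≤ 1) : ∃ T ⊆ X, IsSpanningTree ends T := by
  classical
  obtain ⟨B, hBX, hK, hc⟩ := exists_forest ends X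
  have hB : compNum ends B ≤ 1 := by rw [compNum, hK]; exact h
  refine ⟨B, hBX, connected_of_compNum ends B hB, ?_⟩
  have : 0 < compNum ends B := by
    rw [compNum_eq_card]
    have : Nonempty (Quotient (compSetoid ends B)) := ⟨Quotient.mk _ (Classical.arbitrary V)⟩
    exact Fintype.card_pos
  have : compNum ends B = 1 := by omega
  omega


theorem sum_mdeg [DecidableEq V] (ends : E → V × V) (S : Finset E) (U : Finset V) :
    ∑ w ∈ U, (mdeg ends S w : ℤ) = ∑ e ∈ S,
      ((if (ends e).1 ∈ U then 1 else 0) + (if (ends e).2 ∈ U then 1 else 0) : ℤ) := by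
  unfold mdeg
  push_cast
  rw [Finset.sum_comm]
  refine Finset.sum_congr rfl fun e _ => ?_
  rw [Finset.sum_add_distrib]
  simp

theorem part_ineq [Fintype V] [DecidableEq V] [Fintype E] [DecidableEq E]
    (ends : E → V × V) (m : ℕ) (M : Finset E)
    (hMloop : ∀ e ∈ M, (ends e).1 ≠ (ends e).2)
    (hΔ : ∀ v, mdeg ends M v ≤ m)
    (hG : EdgeConnected ends (2 * m) (Finset.univ : Finset E))
    (A U : Finset V) (hUA : U ⊆ A) (hne : A.Nonempty) (hU : ¬ (A = univ ∧ U = ∅)) :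
    2 * (m : ℤ) + ∑ w ∈ U, ((mdeg ends univ w : ℤ) - 2 * m) ≤
      ∑ e : E, ((if ¬ ((ends e).1 ∈ A ↔ (ends e).2 ∈ A) then 1 else 0) +
        (if (ends e).1 ∈ A ∧ (ends e).2 ∈ A ∧ e ∉ M ∧ ((ends e).1 ∈ U ∨ (ends e).2 ∈ U)
          then 2 else 0) : ℤ) := by
  rw [Finset.sum_sub_distrib, sum_mdeg]
  have hM : ∑ e : E, (if e ∈ M then
      ((if (ends e).1 ∈ U then 1 else 0) + (if (ends e).2 ∈ U then 1 else 0) : ℤ) else 0)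
      ≤ m * U.card := by
    rw [← Finset.sum_filter, Finset.filter_mem_eq_inter, Finset.univ_inter, ← sum_mdeg]
    calc ∑ w ∈ U, (mdeg ends M w : ℤ) ≤ ∑ w ∈ U, (m : ℤ) :=
          Finset.sum_le_sum fun w _ => by exact_mod_cast hΔ w
      _ = m * U.card := by simp [mul_comm]
  have hconst : ∑ w ∈ U, (2 * (m : ℤ)) = 2 * (m * U.card) := by
    simp; ring
  rw [hconst]
  by_cases hB : U = A
  · subst hB
    by_cases h2 : U.card = 1
    · obtain ⟨w, rfl⟩ := Finset.card_eq_one.1 h2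
      have : ∑ e : E, ((if (ends e).1 ∈ ({w} : Finset V) then 1 else 0) +
          (if (ends e).2 ∈ ({w} : Finset V) then 1 else 0) : ℤ) ≤ 
          ∑ e : E, ((if ¬ ((ends e).1 ∈ ({w} : Finset V) ↔ (ends e).2 ∈ ({w} : Finset V))
            then 1 else 0) +
        (if (ends e).1 ∈ ({w} : Finset V) ∧ (ends e).2 ∈ ({w} : Finset V) ∧ e ∉ M ∧
          ((ends e).1 ∈ ({w} : Finset V) ∨ (ends e).2 ∈ ({w} : Finset V))
          then 2 else 0) : ℤ) := by
        refine Finset.sum_le_sum fun e _ => ?_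
        have := hMloop e
        simp only [Finset.mem_singleton]
        by_cases h1 : (ends e).1 = w <;> by_cases h2 : (ends e).2 = w <;> by_cases h3 : e ∈ M <;>
          simp_all
      simp only [Finset.card_singleton]
      push_cast
      linarith
    · have hc : 2 ≤ U.card := by
        have := hne.card_pos
        omega
      have hc' : (m : ℤ) * 2 ≤ m * U.card := by
        exact_mod_cast Nat.mul_le_mul_left m hc
      have : ∑ e : E, ((if (ends e).1 ∈ U then 1 else 0) +
          (if (ends e).2 ∈ U then 1 else 0) : ℤ) ≤ 
          ∑ e : E, ((if ¬ ((ends e).1 ∈ U ↔ (ends e).2 ∈ U)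
            then 1 else 0) +
        (if (ends e).1 ∈ U ∧ (ends e).2 ∈ U ∧ e ∉ M ∧
          ((ends e).1 ∈ U ∨ (ends e).2 ∈ U)
          then 2 else 0) : ℤ) + ∑ e : E, (if e ∈ M then
      ((if (ends e).1 ∈ U then 1 else 0) + (if (ends e).2 ∈ U then 1 else 0) : ℤ) else 0) := by
        rw [← Finset.sum_add_distrib]
        refine Finset.sum_le_sum fun e _ => ?_
        by_cases h1 : (ends e).1 ∈ U <;> by_cases h2 : (ends e).2 ∈ U <;> by_cases h3 : e ∈ M <;>
          simp [h1, h2, h3]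
      linarith
  · have hcut := hG (A \ U) (by
      rw [Finset.sdiff_nonempty]
      exact fun h => hB (Finset.Subset.antisymm hUA h)) (by
      intro h
      apply hU
      have hA : A = univ := by
        apply Finset.eq_univ_of_forall
        intro v
        have : v ∈ A \ U := h ▸ mem_univ v
        exact (Finset.mem_sdiff.1 this).1
      refine ⟨hA, ?_⟩
      apply Finset.eq_empty_of_forall_notMem
      intro v
      have : v ∈ A \ U := h ▸ mem_univ v
      exact (Finset.mem_sdiff.1 this).2)
    have hcut' : 2 * (m : ℤ) ≤
        ∑ e : E, (if ¬ ((ends e).1 ∈ A \ U ↔ (ends e).2 ∈ A \ U) then 1 else 0 : ℤ) := by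
      unfold cutEdges at hcut
      rw [Finset.card_filter] at hcut
      exact_mod_cast hcut
    have : ∑ e : E, ((if (ends e).1 ∈ U then 1 else 0) +
          (if (ends e).2 ∈ U then 1 else 0) : ℤ) +
          ∑ e : E, (if ¬ ((ends e).1 ∈ A \ U ↔ (ends e).2 ∈ A \ U) then 1 else 0 : ℤ) ≤ 
          ∑ e : E, ((if ¬ ((ends e).1 ∈ A ↔ (ends e).2 ∈ A)
            then 1 else 0) +
        (if (ends e).1 ∈ A ∧ (ends e).2 ∈ A ∧ e ∉ M ∧
          ((ends e).1 ∈ U ∨ (ends e).2 ∈ U)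
          then 2 else 0) : ℤ) + 2 * ∑ e : E, (if e ∈ M then
      ((if (ends e).1 ∈ U then 1 else 0) + (if (ends e).2 ∈ U then 1 else 0) : ℤ) else 0) := by
      rw [Finset.mul_sum, ← Finset.sum_add_distrib, ← Finset.sum_add_distrib]
      refine Finset.sum_le_sum fun e _ => ?_
      have ha := @hUA (ends e).1
      have hb := @hUA (ends e).2
      by_cases h1 : (ends e).1 ∈ U <;> by_cases h2 : (ends e).2 ∈ U <;> by_cases h3 : e ∈ M <;>
      by_cases h4 : (ends e).1 ∈ A <;> by_cases h5 : (ends e).2 ∈ A <;>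
          simp_all
    linarith

theorem partition_ineq [Fintype V] [DecidableEq V] [Fintype E] [DecidableEq E]
    (ends : E → V × V) (m : ℕ) (M : Finset E)
    (hMloop : ∀ e ∈ M, (ends e).1 ≠ (ends e).2)
    (hΔ : ∀ v, mdeg ends M v ≤ m)
    (hG : EdgeConnected ends (2 * m) (Finset.univ : Finset E))
    {Q : Type*} [Fintype Q] [DecidableEq Q] (q : V → Q) (hq : Function.Surjective q)
    (W : Finset V) (hW : ¬ (Fintype.card Q = 1 ∧ W = ∅)) :
    2 * (m : ℤ) * Fintype.card Q + ∑ w ∈ W, ((mdeg ends univ w : ℤ) - 2 * m) ≤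
      2 * ((univ : Finset E).filter fun e => q (ends e).1 ≠ q (ends e).2 ∨
        (e ∉ M ∧ ((ends e).1 ∈ W ∨ (ends e).2 ∈ W))).card := by
  have hpart : ∀ k : Q, 2 * (m : ℤ) + ∑ w ∈ W with q w = k, ((mdeg ends univ w : ℤ) - 2 * m) ≤
      ∑ e : E, (if q (ends e).1 = q (ends e).2 then
        (if q (ends e).1 = k then
          (if e ∉ M ∧ ((ends e).1 ∈ W ∨ (ends e).2 ∈ W) then 2 else 0) else 0)
        else ((if q (ends e).1 = k then 1 else 0) + (if q (ends e).2 = k then 1 else 0)) : ℤ) := by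
    intro k
    refine (part_ineq ends m M hMloop hΔ hG (univ.filter fun v => q v = k)
      (W.filter fun v => q v = k) (Finset.filter_subset_filter _ (Finset.subset_univ _))
      ?_ ?_).trans ?_
    · obtain ⟨v, hv⟩ := hq k
      exact ⟨v, by simp [hv]⟩
    · rintro ⟨h1, h2⟩
      have hall : ∀ v, q v = k := by
        intro v
        have hv := Finset.mem_univ v
        rw [← h1] at hv
        simpa using hv
      apply hW
      constructor
      · rw [Fintype.card_eq_one_iff]
        refine ⟨k, fun y => ?_⟩
        obtain ⟨v, rfl⟩ := hq y
        exact hall v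
      · rw [← h2]
        exact (Finset.filter_true_of_mem fun v _ => hall v).symm
    · refine Finset.sum_le_sum fun e _ => ?_
      simp only [Finset.mem_filter, Finset.mem_univ, true_and]
      by_cases h1 : q (ends e).1 = k <;> by_cases h2 : q (ends e).2 = k
      · simp [h1, h2]
      · have : k ≠ q (ends e).2 := fun h => h2 h.symm
        simp [h1, h2, this]
      · simp [h1, h2]
      · simp [h1, h2]
  have hsum := Finset.sum_le_sum fun k (_ : k ∈ (univ : Finset Q)) => hpart k
  rw [Finset.sum_add_distrib, Finset.sum_fiberwise, Finset.sum_comm] at hsum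
  have hE : ∀ e : E, ∑ k : Q, (if q (ends e).1 = q (ends e).2 then
        (if q (ends e).1 = k then
          (if e ∉ M ∧ ((ends e).1 ∈ W ∨ (ends e).2 ∈ W) then 2 else 0) else 0)
        else ((if q (ends e).1 = k then 1 else 0) + (if q (ends e).2 = k then 1 else 0)) : ℤ)
      = 2 * (if (q (ends e).1 ≠ q (ends e).2 ∨
        (e ∉ M ∧ ((ends e).1 ∈ W ∨ (ends e).2 ∈ W))) then 1 else 0) := by
    intro e
    by_cases h : q (ends e).1 = q (ends e).2
    · simp [h]
    · simp [h, Finset.sum_add_distrib]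
  rw [Finset.sum_congr rfl fun e _ => hE e] at hsum
  rw [Finset.card_filter]
  push_cast
  rw [Finset.mul_sum]
  refine le_trans (le_of_eq ?_) hsum
  simp
  ring

theorem core_ineq [Fintype V] [DecidableEq V] [Fintype E] [DecidableEq E]
    (ends : E → V × V) (m : ℕ) (M M₀ : Finset E)
    (hMloop : ∀ e ∈ M, (ends e).1 ≠ (ends e).2)
    (hΔ : ∀ v, mdeg ends M v ≤ m)
    (hM₀card : M₀.card ≤ m)
    (hG : EdgeConnected ends (2 * m) (Finset.univ : Finset E))
    (z : V) (l : V → ℤ)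
    (hl : ∀ v, l v = (((if v = z
            then (mdeg ends (Finset.univ : Finset E) v + 1) / 2
            else mdeg ends (Finset.univ : Finset E) v / 2 : ℕ)) : ℤ) - (m : ℤ))
    (Y : Finset E) (_hY : Disjoint Y M₀) (W : Finset V) :
    (m : ℤ) * (compNum ends Y - 1) + ∑ w ∈ W, l w ≤
      ((univ : Finset E) \ (Y ∪ M₀)).card +
      (Y.filter fun e => e ∉ M ∧ ((ends e).1 ∈ W ∨ (ends e).2 ∈ W)).card := by
  classical
  rw [compNum_eq_card]
  set q : V → Quotient (compSetoid ends Y) := Quotient.mk _ with hqdef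
  have hYq : ∀ e ∈ Y, q (ends e).1 = q (ends e).2 := fun e he =>
    Quotient.sound (Relation.EqvGen.rel _ _ ⟨e, he, rfl⟩)
  by_cases hW : Fintype.card (Quotient (compSetoid ends Y)) = 1 ∧ W = ∅
  · rw [hW.1, hW.2]
    simp
  have hp := partition_ineq ends m M hMloop hΔ hG q Quotient.mk_surjective W hW
  set Z := ((univ : Finset E).filter fun e => q (ends e).1 ≠ q (ends e).2 ∨
        (e ∉ M ∧ ((ends e).1 ∈ W ∨ (ends e).2 ∈ W))) with hZ
  have hZcard : Z.card ≤ ((univ : Finset E) \ (Y ∪ M₀)).card +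
      (Y.filter fun e => e ∉ M ∧ ((ends e).1 ∈ W ∨ (ends e).2 ∈ W)).card + M₀.card := by
    refine le_trans (Finset.card_le_card ?_)
      ((Finset.card_union_le _ M₀).trans (Nat.add_le_add_right (Finset.card_union_le _ _) _))
    intro e he
    have := hYq e
    simp only [hZ, Finset.mem_filter, Finset.mem_univ, true_and, Finset.mem_union,
      Finset.mem_sdiff] at he ⊢
    tauto
  have hl1 : ∀ v, 2 * l v ≤ ((mdeg ends univ v : ℤ) - 2 * m) + (if v = z then 1 else 0) := by
    intro v
    rw [hl v]
    split_ifs <;> omega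
  have hl2 : 2 * ∑ w ∈ W, l w ≤ ∑ w ∈ W, ((mdeg ends univ w : ℤ) - 2 * m) + 1 := by
    rw [Finset.mul_sum]
    refine (Finset.sum_le_sum fun w _ => hl1 w).trans ?_
    rw [Finset.sum_add_distrib]
    gcongr
    rw [Finset.sum_ite_eq']
    split_ifs <;> simp
  have : (m : ℤ) * ((Fintype.card (Quotient (compSetoid ends Y)) : ℤ) - 1) =
    m * Fintype.card (Quotient (compSetoid ends Y)) - m := by ring
  rw [this]
  rw [mul_assoc] at hp
  generalize (m : ℤ) * Fintype.card (Quotient (compSetoid ends Y)) = t at *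
  omega

theorem cap_sub [DecidableEq E] (k : ℕ) (S A B : Finset E) :
    (min k ((A ∪ B) ∩ S).card : ℤ) + (min k ((A ∩ B) ∩ S).card : ℤ) ≤
      (min k (A ∩ S).card : ℤ) + (min k (B ∩ S).card : ℤ) := by
  have h1 := Finset.card_union_add_card_inter (A ∩ S) (B ∩ S)
  rw [← Finset.union_inter_distrib_right, ← Finset.inter_inter_distrib_right] at h1
  have h2 : ((A ∩ B) ∩ S).card ≤ (A ∩ S).card := 
    Finset.card_le_card (Finset.inter_subset_inter_right Finset.inter_subset_left)
  have h3 : ((A ∩ B) ∩ S).card ≤ (B ∩ S).card := 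
    Finset.card_le_card (Finset.inter_subset_inter_right Finset.inter_subset_right)
  omega

theorem cap_mono [DecidableEq E] (k : ℕ) (S A B : Finset E) (h : A ⊆ B) :
    (min k (A ∩ S).card : ℤ) ≤ (min k (B ∩ S).card : ℤ) := by
  have h2 : (A ∩ S).card ≤ (B ∩ S).card := 
    Finset.card_le_card (Finset.inter_subset_inter_right h)
  omega

/-- A `2m`-edge-connected graph with edge-disjoint loopless factors `M`, `M₀`
(`Δ(M) ≤ m`, `|E(M₀)| ≤ m`) has an `m`-tree-connected factor `H` including `M`, excluding `M₀`,
with `G ∖ E(H ∪ M₀)` being `(0, l)`-partition-connected, where `l(v) = ⌊d_G(v)/2⌋ - m`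
and, for the given vertex `z`, `l(z) = ⌈d_G(z)/2⌉ - m`. -/
theorem statement_3 [Fintype V] [DecidableEq V] [Fintype E] [DecidableEq E]
    (ends : E → V × V) (m : ℕ) (M M₀ : Finset E)
    (hMM₀ : Disjoint M M₀)
    (hMloop : ∀ e ∈ M, (ends e).1 ≠ (ends e).2)
    (hM₀loop : ∀ e ∈ M₀, (ends e).1 ≠ (ends e).2)
    (hΔ : ∀ v, mdeg ends M v ≤ m)
    (hM₀card : M₀.card ≤ m)
    (hG : EdgeConnected ends (2 * m) (Finset.univ : Finset E))
    (z : V) :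
    ∃ H : Finset E, M ⊆ H ∧ Disjoint H M₀ ∧ TreeConnected ends m H ∧
      PartitionConnected ends 0
        (fun v => (((if v = z
            then (mdeg ends (Finset.univ : Finset E) v + 1) / 2
            else mdeg ends (Finset.univ : Finset E) v / 2 : ℕ)) : ℤ) - (m : ℤ))
        ((Finset.univ : Finset E) \ (H ∪ M₀)) := by
  classical
  set l : V → ℤ := fun v => (((if v = z
            then (mdeg ends (Finset.univ : Finset E) v + 1) / 2
            else mdeg ends (Finset.univ : Finset E) v / 2 : ℕ)) : ℤ) - (m : ℤ) with hl
  have hne : Nonempty V := ⟨z⟩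
  have hcore := core_ineq ends m M M₀ hMloop hΔ hM₀card hG z l (fun v => rfl)
  -- edges usable for the vertex `v`
  let S : V → Finset E := fun v =>
    univ.filter fun e => e ∉ M ∧ e ∉ M₀ ∧ ((ends e).1 = v ∨ (ends e).2 = v)
  have hmain : ∀ X : Finset E,
      (m : ℤ) * (compNum ends (X \ M₀) - 1)
        + ∑ v, (((l v).toNat : ℤ) - (min (l v).toNat (X ∩ S v).card : ℤ))
        ≤ (Fintype.card E : ℤ) - X.card := by
    intro X
    let W : Finset V := univ.filter fun v => ((X ∩ S v).card : ℤ) < l v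
    have h1 := hcore (X \ M₀) Finset.sdiff_disjoint W
    have h2 : ∑ v, (((l v).toNat : ℤ) - (min (l v).toNat (X ∩ S v).card : ℤ))
        = ∑ w ∈ W, (l w - ((X ∩ S w).card : ℤ)) := by
      rw [Finset.sum_filter]
      refine Finset.sum_congr rfl fun v _ => ?_
      split_ifs <;> omega
    have h3 : ((X \ M₀).filter fun e => e ∉ M ∧ ((ends e).1 ∈ W ∨ (ends e).2 ∈ W)).card
        ≤ ∑ w ∈ W, (X ∩ S w).card := by
      refine le_trans (Finset.card_le_card ?_) Finset.card_biUnion_le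
      intro e he
      simp only [Finset.mem_filter, Finset.mem_sdiff] at he
      obtain ⟨⟨heX, he0⟩, heM, hw | hw⟩ := he
      · exact Finset.mem_biUnion.2 ⟨_, hw, by simp [S, heX, he0, heM]⟩
      · exact Finset.mem_biUnion.2 ⟨_, hw, by simp [S, heX, he0, heM]⟩
    have h4 : ((univ : Finset E) \ (X \ M₀ ∪ M₀)).card + X.card ≤ Fintype.card E := by
      have h5 : ((univ : Finset E) \ (X \ M₀ ∪ M₀)).card ≤ ((univ : Finset E) \ X).card := by
        apply Finset.card_le_card
        intro e
        simp only [Finset.mem_sdiff, Finset.mem_union, Finset.mem_univ, true_and]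
        tauto
      have h6 := Finset.card_sdiff_add_card_eq_card (Finset.subset_univ X)
      rw [Finset.card_univ] at h6
      omega
    rw [h2, Finset.sum_sub_distrib]
    have h3' : (((X \ M₀).filter fun e => e ∉ M ∧ ((ends e).1 ∈ W ∨ (ends e).2 ∈ W)).card : ℤ)
        ≤ ∑ w ∈ W, ((X ∩ S w).card : ℤ) := by exact_mod_cast h3
    omega
  have hD := hmain ∅
  simp only [Finset.empty_sdiff, compNum_empty, Finset.empty_inter, Finset.card_empty] at hD
  have hD0 : (0 : ℤ) ≤ (Fintype.card E : ℤ) - m * (Fintype.card V - 1)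
      - ∑ v, ((l v).toNat : ℤ) := by
    have h0 : ∑ v, (((l v).toNat : ℤ) - min ((l v).toNat : ℤ) ((0 : ℕ) : ℤ))
        = ∑ v, ((l v).toNat : ℤ) := Finset.sum_congr rfl fun v _ => by omega
    rw [h0] at hD
    push_cast at hD ⊢
    linarith
  obtain ⟨D, hDeq⟩ := Int.eq_ofNat_of_zero_le hD0
  let f : Fin m ⊕ (V ⊕ Unit) → Finset E → ℤ := Sum.elim
    (fun _ X => (Fintype.card V : ℤ) - compNum ends (X \ M₀))
    (Sum.elim (fun v X => (min (l v).toNat (X ∩ S v).card : ℤ))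
      (fun _ X => (min D (X ∩ univ).card : ℤ)))
  have hcn : ∀ X : Finset E, compNum ends X ≤ Fintype.card V := fun X => by
    rw [← compNum_empty ends]
    exact compNum_anti ends (Finset.empty_subset X)
  have hfsum : ∀ X, ∑ i, f i X = m * ((Fintype.card V : ℤ) - compNum ends (X \ M₀))
      + (∑ v, (min (l v).toNat (X ∩ S v).card : ℤ) + (min D X.card : ℤ)) := by
    intro X
    simp [f, Fintype.sum_sum_type]
    ring
  obtain ⟨c, hc⟩ := rado_submod f (by
    rintro (i | v | u)
    · simp [f, compNum_empty]
    · simp [f]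
    · simp [f]) (by
    rintro (i | v | u) A B hAB
    · have := compNum_anti ends (Finset.sdiff_subset_sdiff hAB (subset_refl M₀))
      simp only [f, Sum.elim_inl]
      omega
    · exact cap_mono _ _ _ _ hAB
    · exact cap_mono _ _ _ _ hAB) (by
    rintro (i | v | u) A B
    · have := compNum_super ends (A \ M₀) (B \ M₀)
      rw [← Finset.union_sdiff_distrib, show A \ M₀ ∩ (B \ M₀) = (A ∩ B) \ M₀ by
        ext e; simp only [Finset.mem_inter, Finset.mem_sdiff]; tauto] at this
      simp only [f, Sum.elim_inl]
      omega
    · exact cap_sub _ _ _ _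
    · exact cap_sub _ _ _ _) (by
    intro X
    rw [hfsum]
    have h1 := hmain X
    rw [Finset.sum_sub_distrib] at h1
    have h2 : (0 : ℤ) ≤ m * ((Fintype.card V : ℤ) - compNum ends (X \ M₀)) := by
      have := hcn (X \ M₀)
      apply mul_nonneg <;> omega
    have h3 : (0 : ℤ) ≤ ∑ v, (min (l v).toNat (X ∩ S v).card : ℤ) :=
      Finset.sum_nonneg fun v _ => by omega
    rcases le_total (D : ℤ) X.card with h | h
    · rw [min_eq_left h]
      have : (D : ℤ) = (Fintype.card E : ℤ) - m * (Fintype.card V - 1)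
        - ∑ v, ((l v).toNat : ℤ) := hDeq.symm
      rw [this]
      linarith
    · rw [min_eq_right h]
      linarith)
  -- every class attains its full rank
  have hfull : ∑ i : Fin m, ((1 : ℤ) - (compNum ends
        ((univ.filter fun e => c e = Sum.inl i) \ M₀) : ℤ))
      + ∑ v, ((min (l v).toNat ((univ.filter fun e => c e = Sum.inr (Sum.inl v)) ∩ S v).card : ℤ)
        - ((l v).toNat : ℤ)) ≥ 0 := by
    rw [Fintype.sum_sum_type, Fintype.sum_sum_type] at hc
    simp only [f, Sum.elim_inl, Sum.elim_inr, Finset.univ_unique, Finset.sum_singleton,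
      Finset.sum_sub_distrib] at hc ⊢
    have : (min D ((univ.filter fun e => c e = Sum.inr (Sum.inr default)) ∩ univ).card : ℤ) ≤ D :=
      min_le_left _ _
    have hD2 : (D : ℤ) = (Fintype.card E : ℤ) - m * (Fintype.card V - 1)
        - ∑ v, ((l v).toNat : ℤ) := hDeq.symm
    simp only [Finset.sum_const, Finset.card_univ, Fintype.card_fin, nsmul_eq_mul] at hc ⊢
    have : (m : ℤ) * (Fintype.card V - 1) = m * Fintype.card V - m := by ring
    simp only [mul_one] at *
    linarith
  have hpos : ∀ X : Finset E, (1 : ℤ) - compNum ends X ≤ 0 := by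
    intro X
    have : 0 < compNum ends X := by
      rw [compNum_eq_card]
      have : Nonempty (Quotient (compSetoid ends X)) := ⟨Quotient.mk _ z⟩
      exact Fintype.card_pos
    omega
  have hneg1 : ∀ i ∈ (univ : Finset (Fin m)), ((1 : ℤ) - (compNum ends
        ((univ.filter fun e => c e = Sum.inl i) \ M₀) : ℤ)) ≤ 0 := fun i _ => hpos _
  have hneg2 : ∀ v ∈ (univ : Finset V),
      ((min (l v).toNat ((univ.filter fun e => c e = Sum.inr (Sum.inl v)) ∩ S v).card : ℤ)
        - ((l v).toNat : ℤ)) ≤ 0 := fun v _ => by omega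
  have hs1 := Finset.sum_nonpos hneg1
  have hs2 := Finset.sum_nonpos hneg2
  have he1 := (Finset.sum_eq_zero_iff_of_nonpos hneg1).1 (by linarith)
  have he2 := (Finset.sum_eq_zero_iff_of_nonpos hneg2).1 (by linarith)
  have htree : ∀ i : Fin m, ∃ T ⊆ (univ.filter fun e => c e = Sum.inl i) \ M₀,
      IsSpanningTree ends T := by
    intro i
    apply exists_spanningTree
    have := he1 i (mem_univ i)
    omega
  choose T hT hTs using htree
  have hTc : ∀ i e, e ∈ T i → c e = Sum.inl i ∧ e ∉ M₀ := by
    intro i e he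
    simpa using hT i he
  refine ⟨M ∪ univ.biUnion T, Finset.subset_union_left, ?_, ⟨T, fun i => ⟨?_, hTs i⟩, ?_⟩, ?_⟩
  · rw [Finset.disjoint_union_left]
    refine ⟨hMM₀, ?_⟩
    rw [Finset.disjoint_left]
    intro e he
    obtain ⟨i, _, hi⟩ := Finset.mem_biUnion.1 he
    exact (hTc i e hi).2
  · exact (Finset.subset_biUnion_of_mem T (mem_univ i)).trans Finset.subset_union_right
  · intro i j hij
    rw [Finset.disjoint_left]
    intro e hi hj
    have := (hTc i e hi).1.symm.trans (hTc j e hj).1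
    exact hij (Sum.inl_injective this)
  · refine ⟨∅, Finset.empty_subset _, ⟨fun _ => ∅, fun i => i.elim0, fun i => i.elim0⟩,
      fun e => decide (c e = Sum.inr (Sum.inl (ends e).1)), fun v => ?_⟩
    have h1 := he2 v (mem_univ v)
    have h2 : ((univ.filter fun e => c e = Sum.inr (Sum.inl v)) ∩ S v).card ≤
        outDeg ends (fun e => decide (c e = Sum.inr (Sum.inl (ends e).1)))
          (((univ : Finset E) \ ((M ∪ univ.biUnion T) ∪ M₀)) \ ∅) v := by
      apply Finset.card_le_card
      intro e he
      simp only [S, Finset.mem_inter, Finset.mem_filter, Finset.mem_univ, true_and] at he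
      obtain ⟨hce, heM, he0, hev⟩ := he
      simp only [Finset.mem_filter, Finset.mem_sdiff, Finset.mem_univ, true_and, Finset.mem_union,
        Finset.mem_biUnion, Finset.notMem_empty, not_false_eq_true, and_true]
      constructor
      · rintro ((h | ⟨i, hi⟩) | h)
        · exact heM h
        · have := (hTc i e hi).1
          rw [hce] at this
          cases this
        · exact he0 h
      · unfold otail
        by_cases h : (ends e).1 = v
        · simp [hce, h]
        · have h' : ¬ v = (ends e).1 := fun hh => h hh.symm
          have h3 : (ends e).2 = v := by tauto
          simp [hce, h', h3]
    show l v ≤ _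
    omega
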